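/- The space of hexagonal typical 6-configurations whose three principal diagonals are not concurrent is path-connected: any two such configurations can be joined by a Q-deformation γ₁,…,γ₆ such that for every t ∈ [0,1] the intermediate configuration P_t is a hexagonal typical 6-configuration whose principal diagonals are not concurrent. -/

import Mathlib

open scoped LinearAlgebra.Projectivization
open Projectivization

noncomputable section

/-- The real projective plane: the projectivization of `ℝ³`. -/
abbrev RP2 := ℙ ℝ (Fin 3 → ℝ)

/-- The quotient topology on the real projective plane. -/
instance : TopologicalSpace RP2 :=
  inferInstanceAs (TopologicalSpace (Quotient (projectivizationSetoid ℝ (Fin 3 → ℝ))))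

/-- Three points of `ℙ²(ℝ)` are collinear if they admit linearly dependent representatives. -/
def Collin (a b c : RP2) : Prop :=
  ¬ LinearIndependent ℝ ![a.rep, b.rep, c.rep]

/-- The conic (zero set in `ℙ²(ℝ)`) associated to a quadratic form on `ℝ³`. -/
def ConicSet (q : QuadraticForm ℝ (Fin 3 → ℝ)) : Set RP2 := {p : RP2 | q p.rep = 0}

/-- A set of points is coconic if some conic contains all of them. -/
def Coconic (s : Set RP2) : Prop :=
  ∃ q : QuadraticForm ℝ (Fin 3 → ℝ), q ≠ 0 ∧ ∀ p ∈ s, q p.rep = 0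

/-- A labeled `n`-configuration is simple if it is injective and has no collinear triple. -/
def SimpleCfg {n : ℕ} (f : Fin n → RP2) : Prop :=
  Function.Injective f ∧
    ∀ i j k : Fin n, i ≠ j → i ≠ k → j ≠ k → ¬ Collin (f i) (f j) (f k)

/-- A labeled `n`-configuration is typical if it is simple and no six of its points are coconic. -/
def TypicalCfg {n : ℕ} (f : Fin n → RP2) : Prop :=
  SimpleCfg f ∧ ∀ g : Fin 6 → Fin n, Function.Injective g → ¬ Coconic (Set.range (f ∘ g))

/-- A projective line: the set of points whose representatives lie in a 2-dimensional
subspace of `ℝ³`. -/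
def IsProjLine (L : Set RP2) : Prop :=
  ∃ W : Submodule ℝ (Fin 3 → ℝ), Module.finrank ℝ W = 2 ∧ L = {p : RP2 | p.rep ∈ W}

/-- `p` lies inside the conic of `q` if every projective line through `p` meets the conic. -/
def InsideConic (q : QuadraticForm ℝ (Fin 3 → ℝ)) (p : RP2) : Prop :=
  ∀ L : Set RP2, IsProjLine L → p ∈ L → (L ∩ ConicSet q).Nonempty

/-- `p` lies outside the conic of `q` if some projective line through `p` misses the conic. -/
def OutsideConic (q : QuadraticForm ℝ (Fin 3 → ℝ)) (p : RP2) : Prop :=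
  ∃ L : Set RP2, IsProjLine L ∧ p ∈ L ∧ L ∩ ConicSet q = ∅

/-- A point `f i` of a configuration is dominant if it lies outside every conic passing
through all the other points of the configuration. -/
def Dominant {n : ℕ} (f : Fin n → RP2) (i : Fin n) : Prop :=
  ∀ q : QuadraticForm ℝ (Fin 3 → ℝ), q ≠ 0 → (∀ j, j ≠ i → q ((f j).rep) = 0) →
    OutsideConic q (f i)

/-- A point `f i` of a configuration is subdominant if it lies inside every conic passing
through all the other points of the configuration. -/
def Subdominant {n : ℕ} (f : Fin n → RP2) (i : Fin n) : Prop :=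
  ∀ q : QuadraticForm ℝ (Fin 3 → ℝ), q ≠ 0 → (∀ j, j ≠ i → q ((f j).rep) = 0) →
    InsideConic q (f i)

/-- The affine chart determined by a nonzero linear functional `φ` (with `L∞ = {φ = 0}`):
a point off `L∞` is sent to its representative rescaled to lie on the affine plane `φ = 1`. -/
def chart (φ : (Fin 3 → ℝ) →ₗ[ℝ] ℝ) (p : RP2) : Fin 3 → ℝ := (φ p.rep)⁻¹ • p.rep

/-- Convex position with respect to the affine chart of `φ`: the line `{φ = 0}` misses the
configuration, and in the chart every point lies outside the convex hull of the others. -/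
def ConvexPosWith {n : ℕ} (φ : (Fin 3 → ℝ) →ₗ[ℝ] ℝ) (f : Fin n → RP2) : Prop :=
  φ ≠ 0 ∧ (∀ i, φ (f i).rep ≠ 0) ∧
    ∀ i, chart φ (f i) ∉ convexHull ℝ (chart φ '' (f '' {j | j ≠ i}))

/-- A configuration is in convex position if it is so in some affine chart. -/
def ConvexPos {n : ℕ} (f : Fin n → RP2) : Prop := ∃ φ, ConvexPosWith φ f

/-- The labeling of a configuration is consecutive for the convex position in the chart of `φ`:
each pair `f i`, `f (i+1)` (cyclically) spans an edge of the convex polygon, i.e. is cut out by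
an affine functional which is strictly larger on both of them than on all the other points. -/
def ConsecWith {n : ℕ} [NeZero n] (φ : (Fin 3 → ℝ) →ₗ[ℝ] ℝ) (f : Fin n → RP2) : Prop :=
  ConvexPosWith φ f ∧
    ∀ i : Fin n, ∃ ψ : (Fin 3 → ℝ) →ₗ[ℝ] ℝ,
      ψ (chart φ (f i)) = ψ (chart φ (f (i + 1))) ∧
      ∀ j : Fin n, j ≠ i → j ≠ i + 1 → ψ (chart φ (f j)) < ψ (chart φ (f i))

/-- A configuration is in convex position with consecutive cyclic labeling. -/
def ConsecConvexPos {n : ℕ} [NeZero n] (f : Fin n → RP2) : Prop := ∃ φ, ConsecWith φ f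

/-- A Q-deformation (an `n`-tuple of continuous paths through typical configurations). -/
def QDeformFam (n : ℕ) (γ : Fin n → unitInterval → RP2) : Prop :=
  (∀ i, Continuous (γ i)) ∧ ∀ t : unitInterval, TypicalCfg (fun i => γ i t)

end
noncomputable section

/-- A point `x` lies on the projective line through `p` and `q`. -/
def OnLineThr (x p q : RP2) : Prop :=
  x.rep ∈ Submodule.span ℝ ({p.rep, q.rep} : Set (Fin 3 → ℝ))

/-- The three principal diagonals `p₁p₄`, `p₂p₅`, `p₃p₆` of a consecutively labeled hexagonal
configuration are concurrent (all pass through one common point). -/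
def DiagConcurrent (f : Fin 6 → RP2) : Prop :=
  ∃ x : RP2, OnLineThr x (f 0) (f 3) ∧ OnLineThr x (f 1) (f 4) ∧ OnLineThr x (f 2) (f 5)

/-- The determinant of three vectors of `ℝ³`. -/
def tripleDet (a b c : Fin 3 → ℝ) : ℝ :=
  a 0 * (b 1 * c 2 - b 2 * c 1) - a 1 * (b 0 * c 2 - b 2 * c 0) + a 2 * (b 0 * c 1 - b 1 * c 0)

theorem tripleDet_eq_det (a b c : Fin 3 → ℝ) :
    tripleDet a b c = Matrix.det (Matrix.of ![a, b, c]) := by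
  simp [tripleDet, Matrix.det_fin_three]
  ring

theorem tripleDet_swap_left (a b c : Fin 3 → ℝ) : tripleDet b a c = -tripleDet a b c := by
  simp only [tripleDet]; ring

theorem tripleDet_rotate (a b c : Fin 3 → ℝ) : tripleDet b c a = tripleDet a b c := by
  simp only [tripleDet]; ring

theorem tripleDet_swap_right (a b c : Fin 3 → ℝ) : tripleDet a c b = -tripleDet a b c := by
  simp only [tripleDet]; ring

theorem tripleDet_swap_outer (a b c : Fin 3 → ℝ) : tripleDet c b a = -tripleDet a b c := by
  simp only [tripleDet]; ring

theorem tripleDet_neg (a b c : Fin 3 → ℝ) : tripleDet (-a) (-b) (-c) = -tripleDet a b c := by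
  simp only [tripleDet, Pi.neg_apply]; ring

theorem tripleDet_smul (r s t : ℝ) (a b c : Fin 3 → ℝ) :
    tripleDet (r • a) (s • b) (t • c) = r * s * t * tripleDet a b c := by
  simp only [tripleDet, Pi.smul_apply, smul_eq_mul]; ring

/-- Cramer's rule. -/
theorem tripleDet_cramer (a b c x : Fin 3 → ℝ) :
    tripleDet a b c • x =
      tripleDet x b c • a + tripleDet a x c • b + tripleDet a b x • c := by
  ext i
  fin_cases i <;> simp [tripleDet] <;> ring

theorem linearIndependent_iff_tripleDet_ne_zero (a b c : Fin 3 → ℝ) :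
    LinearIndependent ℝ ![a, b, c] ↔ tripleDet a b c ≠ 0 := by
  rw [tripleDet_eq_det, ← isUnit_iff_ne_zero, ← Matrix.isUnit_iff_isUnit_det,
    ← Matrix.linearIndependent_rows_iff_isUnit]
  rfl

/-- The functional `x ↦ det (a, b, x)`. -/
def tripleDetForm (a b : Fin 3 → ℝ) : (Fin 3 → ℝ) →ₗ[ℝ] ℝ where
  toFun x := tripleDet a b x
  map_add' x y := by simp only [tripleDet, Pi.add_apply]; ring
  map_smul' r x := by simp only [tripleDet, Pi.smul_apply, smul_eq_mul, RingHom.id_apply]; ring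

@[simp] theorem tripleDetForm_apply (a b x : Fin 3 → ℝ) :
    tripleDetForm a b x = tripleDet a b x := rfl

@[simp] theorem tripleDet_self_left (a b : Fin 3 → ℝ) : tripleDet a b a = 0 := by
  simp only [tripleDet]; ring

@[simp] theorem tripleDet_self_right (a b : Fin 3 → ℝ) : tripleDet a b b = 0 := by
  simp only [tripleDet]; ring

/-- A bracket polynomial vanishing exactly when the six points lie on a conic. -/
def conicBracket (V : Fin 6 → Fin 3 → ℝ) : ℝ :=
  tripleDet (V 0) (V 1) (V 2) * tripleDet (V 2) (V 3) (V 4) *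
      tripleDet (V 4) (V 5) (V 0) * tripleDet (V 1) (V 3) (V 5) -
    tripleDet (V 1) (V 2) (V 3) * tripleDet (V 3) (V 4) (V 5) *
      tripleDet (V 5) (V 0) (V 1) * tripleDet (V 0) (V 2) (V 4)

/-- A bracket polynomial vanishing exactly when the principal diagonals are concurrent. -/
def diagBracket (V : Fin 6 → Fin 3 → ℝ) : ℝ :=
  tripleDet (V 0) (V 3) (V 4) * tripleDet (V 1) (V 2) (V 5) -
    tripleDet (V 0) (V 3) (V 1) * tripleDet (V 4) (V 2) (V 5)

/-- Each oriented edge `V i, V (i + 1)` has all other vertices on its positive side. -/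
def PosEdges (V : Fin 6 → Fin 3 → ℝ) : Prop :=
  ∀ i k : Fin 6, k ≠ i → k ≠ i + 1 → 0 < tripleDet (V i) (V (i + 1)) (V k)

/-- `V` consists of representatives of the points of `f`. -/
def Represents (V : Fin 6 → Fin 3 → ℝ) (f : Fin 6 → RP2) : Prop :=
  ∀ i, ∃ c : ℝ, c ≠ 0 ∧ (f i).rep = c • V i

/-- The configurations of the theorem. -/
def NiceHexagon (f : Fin 6 → RP2) : Prop :=
  TypicalCfg f ∧ ConsecConvexPos f ∧ ¬ DiagConcurrent f

theorem diagBracket_eq (V : Fin 6 → Fin 3 → ℝ) :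
    diagBracket V = tripleDet (crossProduct (V 0) (V 3)) (crossProduct (V 1) (V 4))
      (crossProduct (V 2) (V 5)) := by
  simp only [diagBracket, tripleDet, cross_apply]
  simp
  ring

theorem crossProduct_dotProduct (a b x : Fin 3 → ℝ) :
    crossProduct a b ⬝ᵥ x = tripleDet a b x := by
  simp [tripleDet, cross_apply, dotProduct, Fin.sum_univ_three]
  ring

theorem mem_span_pair_of_tripleDet_eq_zero {a b c x : Fin 3 → ℝ} (hc : tripleDet a b c ≠ 0)
    (hx : tripleDet a b x = 0) : x ∈ Submodule.span ℝ {a, b} := by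
  have h := tripleDet_cramer a b c x
  rw [hx, zero_smul, add_zero] at h
  rw [← Submodule.smul_mem_iff _ hc, h]
  exact add_mem (Submodule.smul_mem _ _ (Submodule.subset_span (by simp)))
    (Submodule.smul_mem _ _ (Submodule.subset_span (by simp)))

theorem tripleDet_eq_zero_of_mem_span_pair {a b x : Fin 3 → ℝ}
    (hx : x ∈ Submodule.span ℝ {a, b}) : tripleDet a b x = 0 := by
  obtain ⟨s, t, rfl⟩ := Submodule.mem_span_pair.1 hx
  simp only [tripleDet, Pi.add_apply, Pi.smul_apply, smul_eq_mul]; ring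

theorem diagBracket_eq_zero_iff (V : Fin 6 → Fin 3 → ℝ) :
    diagBracket V = 0 ↔ ∃ x : Fin 3 → ℝ, x ≠ 0 ∧ tripleDet (V 0) (V 3) x = 0 ∧
      tripleDet (V 1) (V 4) x = 0 ∧ tripleDet (V 2) (V 5) x = 0 := by
  rw [diagBracket_eq, tripleDet_eq_det, ← Matrix.exists_mulVec_eq_zero_iff]
  refine exists_congr fun x => and_congr_right fun _ => ?_
  simp only [← crossProduct_dotProduct]
  rw [funext_iff, Fin.forall_fin_succ, Fin.forall_fin_two]
  rfl

theorem PosEdges.neg_comp_subLeft {V : Fin 6 → Fin 3 → ℝ} (h : PosEdges V) (a : Fin 6) :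
    PosEdges fun i => -V (a - i) := by
  intro i k hki hki'
  have h1 := h (a - (i + 1)) (a - k) (fun e => hki' (by simpa using e))
    (fun e => hki (by
      have e' : a - k = a - i := by rw [e]; abel
      simpa using e'))
  have e : a - (i + 1) + 1 = a - i := by abel
  rw [e] at h1
  rw [tripleDet_neg, ← tripleDet_swap_left]
  exact h1

set_option synthInstance.maxSize 1000 in
theorem PosEdges.tripleDet_pos {V : Fin 6 → Fin 3 → ℝ} (h : PosEdges V) {i j k : Fin 6}
    (hij : i < j) (hjk : j < k) : 0 < tripleDet (V i) (V j) (V k) := by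
  have key : ∀ i j k : Fin 6, i < j → j < k →
      (j = i + 1 ∧ k ≠ i ∧ k ≠ i + 1) ∨ (k = j + 1 ∧ i ≠ j ∧ i ≠ j + 1) ∨
        (i = k + 1 ∧ j ≠ k ∧ j ≠ k + 1) ∨ (i = 0 ∧ j = 2 ∧ k = 4) ∨ (i = 1 ∧ j = 3 ∧ k = 5) := by
    decide
  have p02 := h 0 2 (by decide) (by decide)
  have p04 := h 0 4 (by decide) (by decide)
  have p03 := h 0 3 (by decide) (by decide)
  have p30 := h 3 0 (by decide) (by decide)
  have p20 := h 2 0 (by decide) (by decide)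
  have p13 := h 1 3 (by decide) (by decide)
  have p14 := h 1 4 (by decide) (by decide)
  have p15 := h 1 5 (by decide) (by decide)
  have p31 := h 3 1 (by decide) (by decide)
  have p41 := h 4 1 (by decide) (by decide)
  simp only [Fin.reduceAdd, zero_add] at p02 p04 p03 p30 p20 p13 p14 p15 p31 p41
  rcases key i j k hij hjk with ⟨rfl, h1, h2⟩ | ⟨rfl, h1, h2⟩ | ⟨rfl, h1, h2⟩ |
    ⟨rfl, rfl, rfl⟩ | ⟨rfl, rfl, rfl⟩
  · exact h _ _ h1 h2
  · rw [← tripleDet_rotate]; exact h _ _ h1 h2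
  · rw [← tripleDet_rotate, ← tripleDet_rotate]; exact h _ _ h1 h2
  · have e : tripleDet (V 0) (V 2) (V 4) * tripleDet (V 0) (V 1) (V 3) =
        tripleDet (V 0) (V 1) (V 2) * tripleDet (V 3) (V 4) (V 0) +
          tripleDet (V 0) (V 1) (V 4) * tripleDet (V 2) (V 3) (V 0) := by
      simp only [tripleDet]; ring
    exact pos_of_mul_pos_left (e ▸ by positivity) p03.le
  · have e : tripleDet (V 1) (V 3) (V 5) * tripleDet (V 1) (V 2) (V 4) =
        tripleDet (V 1) (V 2) (V 3) * tripleDet (V 4) (V 5) (V 1) +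
          tripleDet (V 1) (V 2) (V 5) * tripleDet (V 3) (V 4) (V 1) := by
      simp only [tripleDet]; ring
    exact pos_of_mul_pos_left (e ▸ by positivity) p14.le

theorem PosEdges.tripleDet_ne_zero {V : Fin 6 → Fin 3 → ℝ} (h : PosEdges V) {i j k : Fin 6}
    (hij : i ≠ j) (hik : i ≠ k) (hjk : j ≠ k) : tripleDet (V i) (V j) (V k) ≠ 0 := by
  rcases lt_or_gt_of_ne hij with h1 | h1 <;> rcases lt_or_gt_of_ne hik with h2 | h2 <;>
    rcases lt_or_gt_of_ne hjk with h3 | h3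
  · exact (h.tripleDet_pos h1 h3).ne'
  · rw [tripleDet_swap_right]; exact neg_ne_zero.2 (h.tripleDet_pos h2 h3).ne'
  · exact absurd (h1.trans h3) h2.asymm
  · rw [tripleDet_rotate]; exact (h.tripleDet_pos h2 h1).ne'
  · rw [tripleDet_swap_left]; exact neg_ne_zero.2 (h.tripleDet_pos h1 h2).ne'
  · exact absurd (h3.trans h1) h2.asymm
  · rw [← tripleDet_rotate]; exact (h.tripleDet_pos h3 h2).ne'
  · rw [tripleDet_swap_outer]; exact neg_ne_zero.2 (h.tripleDet_pos h3 h1).ne'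

theorem Represents.collin_iff {V : Fin 6 → Fin 3 → ℝ} {f : Fin 6 → RP2} (h : Represents V f)
    (i j k : Fin 6) : Collin (f i) (f j) (f k) ↔ tripleDet (V i) (V j) (V k) = 0 := by
  obtain ⟨a, ha, ea⟩ := h i
  obtain ⟨b, hb, eb⟩ := h j
  obtain ⟨c, hc, ec⟩ := h k
  rw [Collin, linearIndependent_iff_tripleDet_ne_zero, not_not, ea, eb, ec, tripleDet_smul]
  simp [ha, hb, hc]

theorem Represents.coconic_iff {V : Fin 6 → Fin 3 → ℝ} {f : Fin 6 → RP2} (h : Represents V f) :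
    Coconic (Set.range f) ↔
      ∃ q : QuadraticForm ℝ (Fin 3 → ℝ), q ≠ 0 ∧ ∀ i, q (V i) = 0 := by
  refine exists_congr fun q => and_congr_right fun _ => ?_
  rw [Set.forall_mem_range]
  refine forall_congr' fun i => ?_
  obtain ⟨c, hc, e⟩ := h i
  rw [e, QuadraticMap.map_smul]
  simp [hc]

theorem exists_quadraticForm_of_conicBracket_eq_zero {V : Fin 6 → Fin 3 → ℝ}
    (hV : ∀ i j k, i ≠ j → i ≠ k → j ≠ k → tripleDet (V i) (V j) (V k) ≠ 0)
    (h : conicBracket V = 0) :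
    ∃ q : QuadraticForm ℝ (Fin 3 → ℝ), q ≠ 0 ∧ ∀ i, q (V i) = 0 := by
  set q : QuadraticForm ℝ (Fin 3 → ℝ) :=
    (tripleDet (V 0) (V 1) (V 2) * tripleDet (V 2) (V 3) (V 4)) •
      QuadraticMap.linMulLin (tripleDetForm (V 0) (V 4)) (tripleDetForm (V 1) (V 3)) -
    (tripleDet (V 1) (V 2) (V 3) * tripleDet (V 0) (V 2) (V 4)) •
      QuadraticMap.linMulLin (tripleDetForm (V 3) (V 4)) (tripleDetForm (V 0) (V 1)) with hq
  have hqx : ∀ x, q x = tripleDet (V 0) (V 1) (V 2) * tripleDet (V 2) (V 3) (V 4) *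
      (tripleDet (V 0) (V 4) x * tripleDet (V 1) (V 3) x) -
      tripleDet (V 1) (V 2) (V 3) * tripleDet (V 0) (V 2) (V 4) *
      (tripleDet (V 3) (V 4) x * tripleDet (V 0) (V 1) x) := fun x => by
    simp [hq]
  refine ⟨q, fun h0 => ?_, fun i => ?_⟩
  · have h1 := hqx (V 0 + V 1)
    have e1 : tripleDet (V 0) (V 4) (V 0 + V 1) = tripleDet (V 0) (V 4) (V 1) := by
      simp only [tripleDet, Pi.add_apply]; ring
    have e2 : tripleDet (V 1) (V 3) (V 0 + V 1) = tripleDet (V 1) (V 3) (V 0) := by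
      simp only [tripleDet, Pi.add_apply]; ring
    have e3 : tripleDet (V 0) (V 1) (V 0 + V 1) = 0 := by
      simp only [tripleDet, Pi.add_apply]; ring
    rw [h0, e1, e2, e3] at h1
    have n1 := hV 0 1 2 (by decide) (by decide) (by decide)
    have n2 := hV 2 3 4 (by decide) (by decide) (by decide)
    have n3 := hV 0 4 1 (by decide) (by decide) (by decide)
    have n4 := hV 1 3 0 (by decide) (by decide) (by decide)
    simp [n1, n2, n3, n4] at h1
  · rw [hqx]
    fin_cases i
    · simp
    · simp
    · simp only [Fin.reduceFinMk, tripleDet_swap_right (V 0) (V 2) (V 4),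
        tripleDet_swap_right (V 1) (V 2) (V 3), tripleDet_rotate (V 2) (V 3) (V 4)]
      ring
    · simp
    · simp
    · simp only [Fin.reduceFinMk]
      rw [conicBracket, tripleDet_rotate (V 0) (V 4) (V 5), ← tripleDet_rotate (V 5) (V 0) (V 1)] at h
      linear_combination h

theorem conicBracket_eq_zero_of_quadraticForm {V : Fin 6 → Fin 3 → ℝ}
    (hV : tripleDet (V 0) (V 2) (V 4) ≠ 0) {q : QuadraticForm ℝ (Fin 3 → ℝ)} (hq : q ≠ 0)
    (h : ∀ i, q (V i) = 0) : conicBracket V = 0 := by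
  by_contra hne
  apply hq
  set d := tripleDet (V 0) (V 2) (V 4) with hd
  have hqx (x : Fin 3 → ℝ) : d ^ 2 * q x =
      tripleDet (V 0) x (V 4) * tripleDet (V 0) (V 2) x * QuadraticMap.polar q (V 2) (V 4) +
      tripleDet x (V 2) (V 4) * tripleDet (V 0) (V 2) x * QuadraticMap.polar q (V 0) (V 4) +
      tripleDet x (V 2) (V 4) * tripleDet (V 0) x (V 4) * QuadraticMap.polar q (V 0) (V 2) := by
    have h1 : d ^ 2 * q x = q (d • x) := by rw [QuadraticMap.map_smul, smul_eq_mul]; ring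
    rw [h1, tripleDet_cramer, QuadraticMap.map_add q (_ + _), QuadraticMap.map_add q]
    simp only [QuadraticMap.map_smul, h, QuadraticMap.polar_add_left, QuadraticMap.polar_smul_left,
      QuadraticMap.polar_smul_right, smul_eq_mul]
    ring
  have e1 := hqx (V 1)
  have e3 := hqx (V 3)
  have e5 := hqx (V 5)
  rw [h, mul_zero] at e1 e3 e5
  have i1 : d * tripleDet (V 1) (V 2) (V 3) =
      tripleDet (V 1) (V 2) (V 4) * tripleDet (V 0) (V 2) (V 3) -
      tripleDet (V 0) (V 2) (V 1) * tripleDet (V 3) (V 2) (V 4) := by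
    simp only [hd, tripleDet]; ring
  have i2 : d * tripleDet (V 3) (V 4) (V 5) =
      tripleDet (V 0) (V 3) (V 4) * tripleDet (V 5) (V 2) (V 4) -
      tripleDet (V 3) (V 2) (V 4) * tripleDet (V 0) (V 5) (V 4) := by
    simp only [hd, tripleDet]; ring
  have i3 : d * tripleDet (V 5) (V 0) (V 1) =
      tripleDet (V 0) (V 2) (V 5) * tripleDet (V 0) (V 1) (V 4) -
      tripleDet (V 0) (V 5) (V 4) * tripleDet (V 0) (V 2) (V 1) := by
    simp only [hd, tripleDet]; ring
  have i4 : d ^ 2 * tripleDet (V 1) (V 3) (V 5) =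
      tripleDet (V 1) (V 2) (V 4) * (tripleDet (V 0) (V 3) (V 4) * tripleDet (V 0) (V 2) (V 5) -
        tripleDet (V 0) (V 2) (V 3) * tripleDet (V 0) (V 5) (V 4)) -
      tripleDet (V 0) (V 1) (V 4) * (tripleDet (V 3) (V 2) (V 4) * tripleDet (V 0) (V 2) (V 5) -
        tripleDet (V 0) (V 2) (V 3) * tripleDet (V 5) (V 2) (V 4)) +
      tripleDet (V 0) (V 2) (V 1) * (tripleDet (V 3) (V 2) (V 4) * tripleDet (V 0) (V 5) (V 4) -
        tripleDet (V 0) (V 3) (V 4) * tripleDet (V 5) (V 2) (V 4)) := by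
    simp only [hd, tripleDet]; ring
  have hQ : d ^ 2 * conicBracket V =
      -(tripleDet (V 0) (V 2) (V 1) * tripleDet (V 3) (V 2) (V 4) * tripleDet (V 0) (V 5) (V 4) *
        (d ^ 2 * tripleDet (V 1) (V 3) (V 5))) -
      (d * tripleDet (V 1) (V 2) (V 3)) * (d * tripleDet (V 3) (V 4) (V 5)) *
        (d * tripleDet (V 5) (V 0) (V 1)) := by
    rw [conicBracket, tripleDet_swap_right (V 0) (V 2) (V 1),
      tripleDet_swap_left (V 3) (V 2) (V 4), ← tripleDet_rotate (V 4) (V 5) (V 0),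
      ← tripleDet_rotate (V 5) (V 0) (V 4), tripleDet_swap_right (V 0) (V 5) (V 4), ← hd]
    ring
  rw [i1, i2, i3, i4] at hQ
  have hd2 : d ^ 2 * conicBracket V ≠ 0 := mul_ne_zero (pow_ne_zero 2 hV) hne
  have hM : Matrix.det !![
      tripleDet (V 0) (V 1) (V 4) * tripleDet (V 0) (V 2) (V 1),
      tripleDet (V 1) (V 2) (V 4) * tripleDet (V 0) (V 2) (V 1),
      tripleDet (V 1) (V 2) (V 4) * tripleDet (V 0) (V 1) (V 4);
      tripleDet (V 0) (V 3) (V 4) * tripleDet (V 0) (V 2) (V 3),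
      tripleDet (V 3) (V 2) (V 4) * tripleDet (V 0) (V 2) (V 3),
      tripleDet (V 3) (V 2) (V 4) * tripleDet (V 0) (V 3) (V 4);
      tripleDet (V 0) (V 5) (V 4) * tripleDet (V 0) (V 2) (V 5),
      tripleDet (V 5) (V 2) (V 4) * tripleDet (V 0) (V 2) (V 5),
      tripleDet (V 5) (V 2) (V 4) * tripleDet (V 0) (V 5) (V 4)] ≠ 0 := by
    intro h0
    apply hd2
    rw [hQ]
    simp only [Matrix.det_fin_three, Matrix.of_apply, Matrix.cons_val', Matrix.cons_val_zero,
      Matrix.cons_val_one, Matrix.cons_val, Matrix.cons_val_fin_one] at h0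
    linear_combination -h0
  have hv := Matrix.eq_zero_of_mulVec_eq_zero hM (v := ![QuadraticMap.polar q (V 2) (V 4),
    QuadraticMap.polar q (V 0) (V 4), QuadraticMap.polar q (V 0) (V 2)]) (by
      ext i
      fin_cases i <;> simp [Matrix.mulVec, dotProduct, Fin.sum_univ_three]
      · linear_combination -e1
      · linear_combination -e3
      · linear_combination -e5)
  have h24 : QuadraticMap.polar q (V 2) (V 4) = 0 := congrFun hv 0
  have h04 : QuadraticMap.polar q (V 0) (V 4) = 0 := congrFun hv 1
  have h02 : QuadraticMap.polar q (V 0) (V 2) = 0 := congrFun hv 2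
  ext x
  have hx := hqx x
  rw [h24, h04, h02] at hx
  simpa [hV] using hx

theorem mem_span_pair_smul_iff {a b x : Fin 3 → ℝ} {r s : ℝ} (hr : r ≠ 0) (hs : s ≠ 0) :
    x ∈ Submodule.span ℝ {r • a, s • b} ↔ x ∈ Submodule.span ℝ {a, b} := by
  rw [Submodule.span_insert, Submodule.span_insert,
    Submodule.span_singleton_smul_eq (IsUnit.mk0 r hr),
    Submodule.span_singleton_smul_eq (IsUnit.mk0 s hs)]

theorem Represents.onLineThr_iff {V : Fin 6 → Fin 3 → ℝ} {f : Fin 6 → RP2} (h : Represents V f)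
    {i j k : Fin 6} (hV : tripleDet (V i) (V j) (V k) ≠ 0) (x : RP2) :
    OnLineThr x (f i) (f j) ↔ tripleDet (V i) (V j) x.rep = 0 := by
  obtain ⟨a, ha, ea⟩ := h i
  obtain ⟨b, hb, eb⟩ := h j
  rw [OnLineThr, ea, eb, mem_span_pair_smul_iff ha hb]
  exact ⟨tripleDet_eq_zero_of_mem_span_pair, mem_span_pair_of_tripleDet_eq_zero hV⟩

theorem Represents.diagConcurrent_iff {V : Fin 6 → Fin 3 → ℝ} {f : Fin 6 → RP2}
    (h : Represents V f)
    (hV : ∀ i j k, i ≠ j → i ≠ k → j ≠ k → tripleDet (V i) (V j) (V k) ≠ 0) :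
    DiagConcurrent f ↔ diagBracket V = 0 := by
  simp only [DiagConcurrent, diagBracket_eq_zero_iff,
    h.onLineThr_iff (hV 0 3 1 (by decide) (by decide) (by decide)),
    h.onLineThr_iff (hV 1 4 0 (by decide) (by decide) (by decide)),
    h.onLineThr_iff (hV 2 5 0 (by decide) (by decide) (by decide))]
  constructor
  · rintro ⟨x, hx⟩
    exact ⟨x.rep, x.rep_nonzero, hx⟩
  · rintro ⟨x, hx0, h0, h1, h2⟩
    obtain ⟨u, hu⟩ := Projectivization.exists_smul_eq_mk_rep ℝ x hx0
    refine ⟨Projectivization.mk ℝ x hx0, ?_⟩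
    rw [← hu]
    have e : ∀ a b, tripleDet a b (u • x) = u * tripleDet a b x := fun a b => by
      exact (tripleDetForm a b).map_smul (u : ℝ) x
    simp only [e, h0, h1, h2, mul_zero, and_self]

theorem Represents.typicalCfg {V : Fin 6 → Fin 3 → ℝ} {f : Fin 6 → RP2} (h : Represents V f)
    (hV : ∀ i j k, i ≠ j → i ≠ k → j ≠ k → tripleDet (V i) (V j) (V k) ≠ 0)
    (hQ : conicBracket V ≠ 0) : TypicalCfg f := by
  refine ⟨⟨fun i j hij => ?_, fun i j k hij hik hjk => ?_⟩, fun g hg => ?_⟩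
  · by_contra hne
    obtain ⟨k, hki, hkj⟩ : ∃ k : Fin 6, i ≠ k ∧ j ≠ k := by
      clear hij; revert i j; decide
    refine hV i j k hne hki hkj ((h.collin_iff i j k).1 ?_)
    rw [hij, Collin, linearIndependent_iff_tripleDet_ne_zero, not_not]
    simp only [tripleDet]; ring
  · rw [h.collin_iff]
    exact hV i j k hij hik hjk
  · rw [(Finite.surjective_of_injective hg).range_comp, h.coconic_iff]
    rintro ⟨q, hq, hq0⟩
    exact hQ (conicBracket_eq_zero_of_quadraticForm
      (hV 0 2 4 (by decide) (by decide) (by decide)) hq hq0)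

theorem TypicalCfg.tripleDet_ne_zero {V : Fin 6 → Fin 3 → ℝ} {f : Fin 6 → RP2}
    (hf : TypicalCfg f) (h : Represents V f) :
    ∀ i j k, i ≠ j → i ≠ k → j ≠ k → tripleDet (V i) (V j) (V k) ≠ 0 := by
  intro i j k hij hik hjk h0
  exact hf.1.2 i j k hij hik hjk ((h.collin_iff i j k).2 h0)

theorem TypicalCfg.conicBracket_ne_zero {V : Fin 6 → Fin 3 → ℝ} {f : Fin 6 → RP2}
    (hf : TypicalCfg f) (h : Represents V f) : conicBracket V ≠ 0 := fun h0 =>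
  hf.2 id Function.injective_id (h.coconic_iff.2
    (exists_quadraticForm_of_conicBracket_eq_zero (hf.tripleDet_ne_zero h) h0))

/-- Points with positively oriented edges are in consecutive convex position. -/
theorem Represents.consecConvexPos {V : Fin 6 → Fin 3 → ℝ} {f : Fin 6 → RP2}
    (h : Represents V f) (hV : PosEdges V) : ConsecConvexPos f := by
  set φ := tripleDetForm (V 0) (V 1) + tripleDetForm (V 2) (V 3) + tripleDetForm (V 4) (V 5)
    with hφ
  have hnn : ∀ i k, 0 ≤ tripleDet (V i) (V (i + 1)) (V k) := fun i k => by
    by_cases h1 : k = i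
    · simp [h1]
    by_cases h2 : k = i + 1
    · simp [h2]
    exact (hV i k h1 h2).le
  have hφpos : ∀ k, 0 < φ (V k) := fun k => by
    simp only [hφ, LinearMap.add_apply, tripleDetForm_apply]
    have n0 := hnn 0 k
    have n2 := hnn 2 k
    have n4 := hnn 4 k
    by_cases hk : k = 0 ∨ k = 1
    · have h2 := hV 2 k (by rcases hk with rfl | rfl <;> decide)
        (by rcases hk with rfl | rfl <;> decide)
      exact add_pos_of_pos_of_nonneg (add_pos_of_nonneg_of_pos n0 h2) n4
    · rw [not_or] at hk
      have h0 := hV 0 k hk.1 hk.2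
      exact add_pos_of_pos_of_nonneg (add_pos_of_pos_of_nonneg h0 n2) n4
  have hchart : ∀ i, chart φ (f i) = (φ (V i))⁻¹ • V i := fun i => by
    obtain ⟨c, hc, e⟩ := h i
    rw [chart, e, map_smul, smul_smul, smul_eq_mul, mul_inv, mul_right_comm, inv_mul_cancel₀ hc,
      one_mul]
  have hform : ∀ a b i, tripleDetForm a b (chart φ (f i)) =
      (φ (V i))⁻¹ * tripleDet a b (V i) := fun a b i => by
    rw [hchart, map_smul, tripleDetForm_apply, smul_eq_mul]
  have hpos : ∀ i k, k ≠ i → k ≠ i + 1 →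
      0 < tripleDetForm (V i) (V (i + 1)) (chart φ (f k)) := fun i k h1 h2 => by
    rw [hform]
    exact mul_pos (inv_pos.2 (hφpos k)) (hV i k h1 h2)
  have hzero : ∀ i, tripleDetForm (V i) (V (i + 1)) (chart φ (f i)) = 0 := fun i => by
    rw [hform, tripleDet_self_left, mul_zero]
  have hzero' : ∀ i, tripleDetForm (V i) (V (i + 1)) (chart φ (f (i + 1))) = 0 := fun i => by
    rw [hform, tripleDet_self_right, mul_zero]
  refine ⟨φ, ⟨fun h0 => (hφpos 0).ne' (by rw [h0]; rfl), fun i => ?_, fun i hi => ?_⟩,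
    fun i => ⟨-tripleDetForm (V i) (V (i + 1)), ?_, fun j h1 h2 => ?_⟩⟩
  · obtain ⟨c, hc, e⟩ := h i
    rw [e, map_smul]
    exact mul_ne_zero hc (hφpos i).ne'
  · set χ := tripleDetForm (V (i - 1)) (V (i - 1 + 1)) + tripleDetForm (V i) (V (i + 1)) with hχ
    have hsub : chart φ '' (f '' {j | j ≠ i}) ⊆ {x | 0 < χ x} := by
      rintro _ ⟨_, ⟨j, hj, rfl⟩, rfl⟩
      simp only [hχ, Set.mem_ofPred_eq, LinearMap.add_apply]
      by_cases h1 : j = i + 1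
      · subst h1
        rw [hzero', add_zero]
        refine hpos _ _ (fun e => ?_) (fun e => ?_)
        · clear * - e; revert i; decide
        · clear * - e; revert i; decide
      · refine add_pos_of_nonneg_of_pos ?_ (hpos i j hj h1)
        rw [hform]
        exact mul_nonneg (inv_pos.2 (hφpos j)).le (hnn _ _)
    have hmem := convexHull_min hsub (convex_halfSpace_gt χ.isLinear 0) hi
    simp only [hχ, Set.mem_ofPred_eq, LinearMap.add_apply, hzero, add_zero] at hmem
    have := hzero' (i - 1)
    rw [sub_add_cancel] at this hmem
    exact hmem.ne' this
  · rw [LinearMap.neg_apply, LinearMap.neg_apply, hzero, hzero']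
  · rw [LinearMap.neg_apply, LinearMap.neg_apply, hzero]
    exact neg_lt_neg (hpos i j h1 h2)

theorem Represents.niceHexagon {V : Fin 6 → Fin 3 → ℝ} {f : Fin 6 → RP2}
    (h : Represents V f) (hV : PosEdges V) (hQ : conicBracket V ≠ 0) (hD : diagBracket V ≠ 0) :
    NiceHexagon f := by
  have h3 : ∀ i j k, i ≠ j → i ≠ k → j ≠ k → tripleDet (V i) (V j) (V k) ≠ 0 :=
    fun _ _ _ => hV.tripleDet_ne_zero
  exact ⟨h.typicalCfg h3 hQ, h.consecConvexPos hV, fun hc => hD ((h.diagConcurrent_iff h3).1 hc)⟩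

theorem Represents.neg {V : Fin 6 → Fin 3 → ℝ} {f : Fin 6 → RP2} (h : Represents V f) :
    Represents (fun i => -V i) f := fun i => by
  obtain ⟨c, hc, e⟩ := h i
  exact ⟨-c, neg_ne_zero.2 hc, by simpa using e⟩

theorem exists_posEdges_of_consecConvexPos {f : Fin 6 → RP2} (hf : TypicalCfg f)
    (hc : ConsecConvexPos f) : ∃ V, Represents V f ∧ PosEdges V := by
  obtain ⟨φ, ⟨-, hφ, -⟩, hedge⟩ := hc
  set W : Fin 6 → Fin 3 → ℝ := fun i => chart φ (f i) with hW
  have hrep : Represents W f := fun i =>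
    ⟨φ (f i).rep, hφ i, by simp only [hW, chart, smul_smul, mul_inv_cancel₀ (hφ i), one_smul]⟩
  have hφW : ∀ i, φ (W i) = 1 := fun i => by
    simp only [hW, chart, map_smul, smul_eq_mul, inv_mul_cancel₀ (hφ i)]
  have hne := hf.tripleDet_ne_zero hrep
  have hsame : ∀ i j k, j ≠ i → j ≠ i + 1 → k ≠ i → k ≠ i + 1 →
      0 < tripleDet (W i) (W (i + 1)) (W j) → 0 < tripleDet (W i) (W (i + 1)) (W k) := by
    intro i j k hji hji' hki hki' hj
    obtain ⟨ψ, h1, h2⟩ := hedge i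
    have e := congrArg (ψ (W i) • φ - ψ) (tripleDet_cramer (W i) (W (i + 1)) (W j) (W k))
    simp only [map_add, map_smul, LinearMap.sub_apply, LinearMap.smul_apply, hφW, smul_eq_mul] at e
    have hj' : ψ (W j) < ψ (W i) := h2 j hji hji'
    have hk' : ψ (W k) < ψ (W i) := h2 k hki hki'
    have h1' : ψ (W i) = ψ (W (i + 1)) := h1
    rw [← h1', mul_one, sub_self, mul_zero, mul_zero, zero_add, zero_add] at e
    exact pos_of_mul_pos_left (e ▸ mul_pos hj (sub_pos.2 hk')) (sub_pos.2 hj').le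
  have hstep : ∀ i, 0 < tripleDet (W i) (W (i + 1)) (W (i + 1 + 1)) →
      0 < tripleDet (W (i + 1)) (W (i + 1 + 1)) (W (i + 1 + 1 + 1)) := by
    intro i hi
    rw [← tripleDet_rotate] at hi
    refine hsame (i + 1) i _ ?_ ?_ ?_ ?_ hi <;> clear * - <;> revert i <;> decide
  have hne1 : ∀ i : Fin 6, i + 1 + 1 ≠ i := by decide
  have hne2 : ∀ i : Fin 6, i + 1 + 1 ≠ i + 1 := by decide
  by_cases hp : ∃ i, 0 < tripleDet (W i) (W (i + 1)) (W (i + 1 + 1))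
  · obtain ⟨i, hi⟩ := hp
    have hall : ∀ j, 0 < tripleDet (W j) (W (j + 1)) (W (j + 1 + 1)) := by
      have hcyc : ∀ i j : Fin 6, j = i ∨ j = i + 1 ∨ j = i + 1 + 1 ∨ j = i + 1 + 1 + 1 ∨
          j = i + 1 + 1 + 1 + 1 ∨ j = i + 1 + 1 + 1 + 1 + 1 := by decide
      have h1 := hstep _ hi
      have h2 := hstep _ h1
      have h3 := hstep _ h2
      have h4 := hstep _ h3
      have h5 := hstep _ h4
      intro j
      rcases hcyc i j with rfl | rfl | rfl | rfl | rfl | rfl <;> assumption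
    exact ⟨W, hrep, fun j k hk hk' => hsame j (j + 1 + 1) k (hne1 j) (hne2 j) hk hk' (hall j)⟩
  · refine ⟨fun i => -W i, hrep.neg, fun j k hk hk' => ?_⟩
    rw [tripleDet_neg, neg_pos]
    refine lt_of_le_of_ne (not_lt.1 fun h0 => hp ⟨j, ?_⟩)
      (hne _ _ _ (by clear * -; revert j; decide) hk.symm hk'.symm)
    exact hsame j k (j + 1 + 1) hk hk' (hne1 j) (hne2 j) h0

theorem NiceHexagon.exists_represents {f : Fin 6 → RP2} (hf : NiceHexagon f) :
    ∃ V, Represents V f ∧ PosEdges V ∧ conicBracket V ≠ 0 ∧ diagBracket V ≠ 0 := by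
  obtain ⟨V, hV, hpos⟩ := exists_posEdges_of_consecConvexPos hf.1 hf.2.1
  exact ⟨V, hV, hpos, hf.1.conicBracket_ne_zero hV, fun h0 =>
    hf.2.2 ((hV.diagConcurrent_iff (hf.1.tripleDet_ne_zero hV)).2 h0)⟩

theorem Represents.comp_subLeft {V : Fin 6 → Fin 3 → ℝ} {f : Fin 6 → RP2} (h : Represents V f)
    (a : Fin 6) : Represents (fun i => -V (a - i)) fun i => f (a - i) :=
  fun i => h.neg (a - i)

theorem conicBracket_reflect_edge (V : Fin 6 → Fin 3 → ℝ) :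
    conicBracket (fun i => -V (5 - i)) = -conicBracket V := by
  simp only [conicBracket, tripleDet_neg]
  have e : ((5 : Fin 6) - 0 = 5) ∧ ((5 : Fin 6) - 1 = 4) ∧ ((5 : Fin 6) - 2 = 3) ∧
    ((5 : Fin 6) - 3 = 2) ∧ ((5 : Fin 6) - 4 = 1) ∧ ((5 : Fin 6) - 5 = 0) := by decide
  simp only [e]
  rw [tripleDet_swap_outer (V 3) (V 4) (V 5), tripleDet_swap_outer (V 1) (V 2) (V 3),
    tripleDet_swap_outer (V 5) (V 0) (V 1), tripleDet_swap_outer (V 0) (V 2) (V 4),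
    tripleDet_swap_outer (V 2) (V 3) (V 4), tripleDet_swap_outer (V 0) (V 1) (V 2),
    tripleDet_swap_outer (V 4) (V 5) (V 0), tripleDet_swap_outer (V 1) (V 3) (V 5)]
  ring

theorem diagBracket_reflect_edge (V : Fin 6 → Fin 3 → ℝ) :
    diagBracket (fun i => -V (5 - i)) = diagBracket V := by
  simp only [diagBracket, tripleDet_neg]
  have e : ((5 : Fin 6) - 0 = 5) ∧ ((5 : Fin 6) - 1 = 4) ∧ ((5 : Fin 6) - 2 = 3) ∧
    ((5 : Fin 6) - 3 = 2) ∧ ((5 : Fin 6) - 4 = 1) ∧ ((5 : Fin 6) - 5 = 0) := by decide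
  simp only [e, tripleDet]
  ring

theorem conicBracket_reflect_vertex (V : Fin 6 → Fin 3 → ℝ) :
    conicBracket (fun i => -V (0 - i)) = conicBracket V := by
  simp only [conicBracket, tripleDet_neg]
  have e : ((0 : Fin 6) - 0 = 0) ∧ ((0 : Fin 6) - 1 = 5) ∧ ((0 : Fin 6) - 2 = 4) ∧
    ((0 : Fin 6) - 3 = 3) ∧ ((0 : Fin 6) - 4 = 2) ∧ ((0 : Fin 6) - 5 = 1) := by decide
  simp only [e]
  rw [tripleDet_swap_outer (V 4) (V 5) (V 0), tripleDet_swap_outer (V 2) (V 3) (V 4),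
    tripleDet_swap_outer (V 0) (V 1) (V 2), tripleDet_swap_outer (V 1) (V 3) (V 5),
    tripleDet_swap_outer (V 3) (V 4) (V 5), tripleDet_swap_outer (V 1) (V 2) (V 3),
    tripleDet_swap_outer (V 5) (V 0) (V 1), tripleDet_swap_right (V 0) (V 2) (V 4)]
  ring

theorem diagBracket_reflect_vertex (V : Fin 6 → Fin 3 → ℝ) :
    diagBracket (fun i => -V (0 - i)) = -diagBracket V := by
  simp only [diagBracket, tripleDet_neg]
  have e : ((0 : Fin 6) - 0 = 0) ∧ ((0 : Fin 6) - 1 = 5) ∧ ((0 : Fin 6) - 2 = 4) ∧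
    ((0 : Fin 6) - 3 = 3) ∧ ((0 : Fin 6) - 4 = 2) ∧ ((0 : Fin 6) - 5 = 1) := by decide
  simp only [e, tripleDet]
  ring

theorem NiceHexagon.reflect_edge {f : Fin 6 → RP2} (hf : NiceHexagon f) :
    NiceHexagon fun i => f (5 - i) := by
  obtain ⟨V, hV, hpos, hQ, hD⟩ := hf.exists_represents
  exact (hV.comp_subLeft 5).niceHexagon (hpos.neg_comp_subLeft 5)
    (by rwa [conicBracket_reflect_edge, neg_ne_zero]) (by rwa [diagBracket_reflect_edge])

theorem NiceHexagon.reflect_vertex {f : Fin 6 → RP2} (hf : NiceHexagon f) :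
    NiceHexagon fun i => f (0 - i) := by
  obtain ⟨V, hV, hpos, hQ, hD⟩ := hf.exists_represents
  exact (hV.comp_subLeft 0).niceHexagon (hpos.neg_comp_subLeft 0)
    (by rwa [conicBracket_reflect_vertex]) (by rwa [diagBracket_reflect_vertex, neg_ne_zero])

/-- Representatives of one of the four labelled components. -/
def hexagonCell : Set (Fin 6 → Fin 3 → ℝ) :=
  {V | PosEdges V ∧ 0 < conicBracket V ∧ 0 < diagBracket V}

theorem Represents.niceHexagon_of_mem_hexagonCell {V : Fin 6 → Fin 3 → ℝ} {f : Fin 6 → RP2}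
    (h : Represents V f) (hV : V ∈ hexagonCell) : NiceHexagon f :=
  h.niceHexagon hV.1 (ne_of_gt hV.2.1) (ne_of_gt hV.2.2)

/-- Relabellings of a configuration by the dihedral group move it into the distinguished cell. -/
theorem NiceHexagon.exists_perm {f : Fin 6 → RP2} (hf : NiceHexagon f) :
    ∃ σ : Equiv.Perm (Fin 6), (∀ h, NiceHexagon h → NiceHexagon (h ∘ σ.symm)) ∧
      ∃ V ∈ hexagonCell, Represents V (f ∘ σ) := by
  have main : ∀ f : Fin 6 → RP2, ∀ V, Represents V f → PosEdges V → 0 < conicBracket V →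
      diagBracket V ≠ 0 → ∃ σ : Equiv.Perm (Fin 6),
        (∀ h, NiceHexagon h → NiceHexagon (h ∘ σ.symm)) ∧
        ∃ V ∈ hexagonCell, Represents V (f ∘ σ) := by
    intro f V hV hpos hQ hD
    rcases hD.lt_or_gt with hD | hD
    · exact ⟨Function.Involutive.toPerm (fun i => 0 - i) (sub_sub_self 0),
        fun h hh => hh.reflect_vertex, _,
        ⟨hpos.neg_comp_subLeft 0, by rwa [conicBracket_reflect_vertex],
          by rwa [diagBracket_reflect_vertex, neg_pos]⟩, hV.comp_subLeft 0⟩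
    · exact ⟨Equiv.refl _, fun h hh => hh, V, ⟨hpos, hQ, hD⟩, hV⟩
  obtain ⟨V, hV, hpos, hQ, hD⟩ := hf.exists_represents
  rcases hQ.lt_or_gt with hQ | hQ
  · obtain ⟨σ, hσ, V', hV', hrep⟩ := main _ _ (hV.comp_subLeft 5) (hpos.neg_comp_subLeft 5)
      (by rwa [conicBracket_reflect_edge, neg_pos]) (by rwa [diagBracket_reflect_edge])
    exact ⟨σ.trans (Function.Involutive.toPerm (fun i => 5 - i) (sub_sub_self 5)),
      fun h hh => (hσ h hh).reflect_edge, V', hV', hrep⟩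
  · exact main f V hV hpos hQ hD

theorem joinedIn_crossProduct_ne_zero {b c d : Fin 3 → ℝ} (hc : crossProduct b c ≠ 0)
    (hd : crossProduct b d ≠ 0) : JoinedIn {x | crossProduct b x ≠ 0} c d := by
  have hb : b ≠ 0 := by
    rintro rfl
    simp at hc
  have hset : {x | crossProduct b x ≠ 0} = ((ℝ ∙ b : Submodule ℝ (Fin 3 → ℝ)) : Set _)ᶜ := by
    ext x
    rw [Set.mem_ofPred_eq, crossProduct_ne_zero_iff_linearIndependent,
      LinearIndependent.pair_iff' hb, Set.mem_compl_iff, SetLike.mem_coe,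
      Submodule.mem_span_singleton, not_exists]
  have hrank : 1 < Module.rank ℝ ((Fin 3 → ℝ) ⧸ (ℝ ∙ b : Submodule ℝ (Fin 3 → ℝ))) := by
    have h := Submodule.finrank_quotient_add_finrank (ℝ ∙ b : Submodule ℝ (Fin 3 → ℝ))
    rw [finrank_span_singleton hb, Module.finrank_fin_fun] at h
    rw [← Module.finrank_eq_rank, ← Nat.cast_one, Nat.cast_lt]
    omega
  rw [hset]
  exact (isPathConnected_compl_of_one_lt_codim hrank).joinedIn c (hset ▸ hc) d (hset ▸ hd)

/-- Pairs of linearly independent vectors of `ℝ³` form a path-connected space. -/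
theorem joinedIn_independent_pairs {b c b' c' : Fin 3 → ℝ} (h : crossProduct b c ≠ 0)
    (h' : crossProduct b' c' ≠ 0) :
    JoinedIn {p : (Fin 3 → ℝ) × (Fin 3 → ℝ) | crossProduct p.1 p.2 ≠ 0} (b, c) (b', c') := by
  have hne : ∀ x y : Fin 3 → ℝ, crossProduct x y ≠ 0 → crossProduct y x ≠ 0 := fun x y hxy => by
    rw [← cross_anticomm]; exact neg_ne_zero.2 hxy
  have hb : b ≠ 0 := by rintro rfl; simp at h
  have hb' : b' ≠ 0 := by rintro rfl; simp at h'
  obtain ⟨d, hd⟩ : ∃ d, d ∉ Submodule.span ℝ {b, b'} := by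
    by_contra! hall
    have h1 : Module.finrank ℝ (Submodule.span ℝ ({b, b'} : Set (Fin 3 → ℝ))) ≤ 2 := by
      have := finrank_span_finset_le_card (R := ℝ) ({b, b'} : Finset (Fin 3 → ℝ))
      rw [Finset.coe_pair] at this
      exact this.trans Finset.card_le_two
    rw [(Submodule.eq_top_iff'.2 hall), finrank_top, Module.finrank_fin_fun] at h1
    omega
  have hd1 : ∀ x ∈ ({b, b'} : Set (Fin 3 → ℝ)), x ≠ 0 → crossProduct x d ≠ 0 := by
    intro x hx hx0
    rw [crossProduct_ne_zero_iff_linearIndependent, LinearIndependent.pair_iff' hx0]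
    rintro a rfl
    exact hd (Submodule.smul_mem _ _ (Submodule.subset_span hx))
  have hbd := hd1 b (by simp) hb
  have hbd' := hd1 b' (by simp) hb'
  have j1 := (joinedIn_crossProduct_ne_zero h hbd).map (f := fun x => (b, x)) (by fun_prop)
  have j2 := (joinedIn_crossProduct_ne_zero (hne _ _ hbd) (hne _ _ hbd')).map
    (f := fun x => (x, d)) (by fun_prop)
  have j3 := (joinedIn_crossProduct_ne_zero hbd' h').map (f := fun x => (b', x)) (by fun_prop)
  refine ((j1.mono ?_).trans (j2.mono ?_)).trans (j3.mono ?_)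
  · rintro _ ⟨x, hx, rfl⟩; exact hx
  · rintro _ ⟨x, hx, rfl⟩; exact hne _ _ hx
  · rintro _ ⟨x, hx, rfl⟩; exact hx

/-- Positively oriented bases of `ℝ³` form a path-connected space. -/
theorem joinedIn_tripleDet_pos {a b c a' b' c' : Fin 3 → ℝ} (h : 0 < tripleDet a b c)
    (h' : 0 < tripleDet a' b' c') :
    JoinedIn {p : (Fin 3 → ℝ) × (Fin 3 → ℝ) × (Fin 3 → ℝ) | 0 < tripleDet p.1 p.2.1 p.2.2}
      (a, b, c) (a', b', c') := by
  have hcross : ∀ b c : Fin 3 → ℝ, crossProduct b c ≠ 0 →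
      0 < tripleDet (crossProduct b c) b c := fun b c hbc => by
    rw [← tripleDet_rotate, ← crossProduct_dotProduct]
    exact lt_of_le_of_ne (Finset.sum_nonneg fun i _ => mul_self_nonneg _)
      (Ne.symm (dotProduct_self_eq_zero.not.2 hbc))
  have hne : ∀ a b c : Fin 3 → ℝ, 0 < tripleDet a b c → crossProduct b c ≠ 0 := by
    intro a b c h0 hbc
    rw [← tripleDet_rotate, ← crossProduct_dotProduct, hbc, zero_dotProduct] at h0
    exact h0.false
  have hfirst : ∀ a b c : Fin 3 → ℝ, 0 < tripleDet a b c →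
      JoinedIn {p : (Fin 3 → ℝ) × (Fin 3 → ℝ) × (Fin 3 → ℝ) | 0 < tripleDet p.1 p.2.1 p.2.2}
        (a, b, c) (crossProduct b c, b, c) := by
    intro a b c h0
    have hconv : Convex ℝ {x | 0 < tripleDetForm b c x} :=
      convex_halfSpace_gt (tripleDetForm b c).isLinear 0
    have j := JoinedIn.of_segment_subset (hconv.segment_subset (x := a) (y := crossProduct b c)
      (by simpa [tripleDet_rotate] using h0)
      (by simpa [tripleDet_rotate] using hcross b c (hne a b c h0)))
    refine (j.map (f := fun x => (x, b, c)) (by fun_prop)).mono ?_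
    rintro _ ⟨x, hx, rfl⟩
    simpa [tripleDet_rotate] using hx
  refine ((hfirst a b c h).trans ?_).trans (hfirst a' b' c' h').symm
  have j := (joinedIn_independent_pairs (hne a b c h) (hne a' b' c' h')).map
    (f := fun p => (crossProduct p.1 p.2, p.1, p.2)) (by
      simp only [cross_apply]
      fun_prop)
  refine j.mono ?_
  rintro _ ⟨⟨x, y⟩, hxy, rfl⟩
  exact hcross x y hxy

/-- The hexagon with alternate vertices `u, v, w` whose other vertices have the coordinates `x`
in the basis `u, v, w`, up to sign. -/
def hexagonOf (u v w : Fin 3 → ℝ) (x : Fin 3 → Fin 3 → ℝ) : Fin 6 → Fin 3 → ℝ :=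
  ![u, x 0 0 • u + x 1 0 • v - x 2 0 • w, v, -x 0 1 • u + x 1 1 • v + x 2 1 • w, w,
    x 0 2 • u - x 1 2 • v + x 2 2 • w]

/-- The determinants `det (V i, V (i + 1), V k)` of `V = hexagonOf u v w x`, divided by
`det (u, v, w)`. -/
def edgeMinor (x : Fin 3 → Fin 3 → ℝ) : Fin 6 → Fin 6 → ℝ :=
  ![![0, 0, x 2 0, x 1 0 * x 2 1 + x 2 0 * x 1 1, x 1 0, x 1 0 * x 2 2 - x 2 0 * x 1 2],
    ![x 2 0, 0, 0, x 0 0 * x 2 1 - x 0 1 * x 2 0, x 0 0, x 0 0 * x 2 2 + x 2 0 * x 0 2],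
    ![x 2 1, x 0 0 * x 2 1 - x 0 1 * x 2 0, 0, 0, x 0 1, x 2 1 * x 0 2 + x 0 1 * x 2 2],
    ![x 1 1, x 0 0 * x 1 1 + x 1 0 * x 0 1, x 0 1, 0, 0, x 0 2 * x 1 1 - x 0 1 * x 1 2],
    ![x 1 2, x 0 2 * x 1 0 + x 1 2 * x 0 0, x 0 2, x 0 2 * x 1 1 - x 0 1 * x 1 2, 0, 0],
    ![0, x 1 0 * x 2 2 - x 2 0 * x 1 2, x 2 2, x 1 1 * x 2 2 + x 2 1 * x 1 2, x 1 2, 0]]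

theorem tripleDet_hexagonOf_edge (u v w : Fin 3 → ℝ) (x : Fin 3 → Fin 3 → ℝ) (i k : Fin 6) :
    tripleDet (hexagonOf u v w x i) (hexagonOf u v w x (i + 1)) (hexagonOf u v w x k) =
      edgeMinor x i k * tripleDet u v w := by
  fin_cases i <;> fin_cases k <;> simp [hexagonOf, edgeMinor, tripleDet] <;> ring

theorem tripleDet_hexagonOf_odd (u v w : Fin 3 → ℝ) (x : Fin 3 → Fin 3 → ℝ) :
    tripleDet (hexagonOf u v w x 1) (hexagonOf u v w x 3) (hexagonOf u v w x 5) =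
      (x 0 0 * x 1 1 * x 2 2 + x 0 0 * x 1 2 * x 2 1 + x 0 1 * x 1 0 * x 2 2
        + x 0 2 * x 1 0 * x 2 1 + x 0 2 * x 1 1 * x 2 0 - x 0 1 * x 1 2 * x 2 0) *
        tripleDet u v w := by
  simp [hexagonOf, tripleDet]
  ring

theorem conicBracket_hexagonOf (u v w : Fin 3 → ℝ) (x : Fin 3 → Fin 3 → ℝ) :
    conicBracket (hexagonOf u v w x) =
      (x 0 0 * x 1 1 * x 2 2 * (x 0 1 * x 1 2 * x 2 0) +
        x 0 1 * x 1 2 * x 2 0 * (x 0 2 * x 1 0 * x 2 1) +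
        x 0 1 * x 1 0 * x 2 2 * (x 0 2 * x 1 1 * x 2 0) +
        x 0 2 * x 1 1 * x 2 0 * (x 0 0 * x 1 2 * x 2 1) +
        x 0 1 * x 1 0 * x 2 2 * (x 0 0 * x 1 2 * x 2 1) -
        x 0 0 * x 1 1 * x 2 2 * (x 0 2 * x 1 0 * x 2 1)) * tripleDet u v w ^ 4 := by
  have e := tripleDet_hexagonOf_edge u v w x
  have e0 := e 0 2
  have e1 := e 1 3
  have e2 := e 2 4
  have e3 := e 3 5
  have e4 := e 4 0
  have e5 := e 5 1
  have e' : tripleDet (hexagonOf u v w x 0) (hexagonOf u v w x 2) (hexagonOf u v w x 4) =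
    tripleDet u v w := rfl
  have hs : (0 : Fin 6) + 1 = 1 ∧ (1 : Fin 6) + 1 = 2 ∧ (2 : Fin 6) + 1 = 3 ∧
    (3 : Fin 6) + 1 = 4 ∧ (4 : Fin 6) + 1 = 5 ∧ (5 : Fin 6) + 1 = 0 := by decide
  simp only [hs] at e0 e1 e2 e3 e4 e5
  rw [conicBracket, e0, e1, e2, e3, e4, e5, e', tripleDet_hexagonOf_odd]
  simp only [edgeMinor]
  simp
  ring

theorem diagBracket_hexagonOf (u v w : Fin 3 → ℝ) (x : Fin 3 → Fin 3 → ℝ) :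
    diagBracket (hexagonOf u v w x) =
      (x 0 0 * x 1 1 * x 2 2 - x 0 2 * x 1 0 * x 2 1) * tripleDet u v w ^ 2 := by
  simp [diagBracket, hexagonOf, tripleDet]
  ring

/-- The positive coordinates describing the hexagons of `hexagonCell`. -/
def coordCell : Set (Fin 3 → Fin 3 → ℝ) :=
  {x | (∀ i j, 0 < x i j) ∧ x 2 0 * x 1 2 < x 1 0 * x 2 2 ∧ x 0 1 * x 2 0 < x 0 0 * x 2 1 ∧
    x 0 1 * x 1 2 < x 0 2 * x 1 1 ∧ x 0 2 * x 1 0 * x 2 1 < x 0 0 * x 1 1 * x 2 2 ∧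
    x 0 0 * x 1 1 * x 2 2 * (x 0 2 * x 1 0 * x 2 1) <
      x 0 0 * x 1 1 * x 2 2 * (x 0 1 * x 1 2 * x 2 0) +
        x 0 1 * x 1 2 * x 2 0 * (x 0 2 * x 1 0 * x 2 1) +
        x 0 1 * x 1 0 * x 2 2 * (x 0 2 * x 1 1 * x 2 0) +
        x 0 2 * x 1 1 * x 2 0 * (x 0 0 * x 1 2 * x 2 1) +
        x 0 1 * x 1 0 * x 2 2 * (x 0 0 * x 1 2 * x 2 1)}

theorem hexagonOf_mem_hexagonCell {u v w : Fin 3 → ℝ} {x : Fin 3 → Fin 3 → ℝ}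
    (h : 0 < tripleDet u v w) (hx : x ∈ coordCell) : hexagonOf u v w x ∈ hexagonCell := by
  obtain ⟨hpos, h1, h2, h3, h4, h5⟩ := hx
  refine ⟨fun i k hk hk' => ?_, ?_, ?_⟩
  · rw [tripleDet_hexagonOf_edge]
    refine mul_pos ?_ h
    rw [← sub_pos] at h1 h2 h3
    have hx00 := hpos 0 0
    have hx01 := hpos 0 1
    have hx02 := hpos 0 2
    have hx10 := hpos 1 0
    have hx11 := hpos 1 1
    have hx12 := hpos 1 2
    have hx20 := hpos 2 0
    have hx21 := hpos 2 1
    have hx22 := hpos 2 2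
    fin_cases i <;> fin_cases k <;>
      first
        | exact absurd rfl hk
        | exact absurd rfl hk'
        | (simp only [edgeMinor]; first | assumption | (simp; positivity))
  · rw [conicBracket_hexagonOf]
    exact mul_pos (sub_pos.2 h5) (pow_pos h 4)
  · rw [diagBracket_hexagonOf]
    exact mul_pos (sub_pos.2 h4) (pow_pos h 2)

theorem exists_hexagonOf_of_mem_hexagonCell {V : Fin 6 → Fin 3 → ℝ} (hV : V ∈ hexagonCell) :
    ∃ u v w x, 0 < tripleDet u v w ∧ x ∈ coordCell ∧ V = hexagonOf u v w x := by
  obtain ⟨hpos, hQ, hD⟩ := hV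
  have hd : 0 < tripleDet (V 0) (V 2) (V 4) := hpos.tripleDet_pos (by decide) (by decide)
  set d := tripleDet (V 0) (V 2) (V 4) with hd_def
  set x : Fin 3 → Fin 3 → ℝ :=
    ![![tripleDet (V 1) (V 2) (V 4) / d, tripleDet (V 2) (V 3) (V 4) / d,
        tripleDet (V 2) (V 4) (V 5) / d],
      ![tripleDet (V 0) (V 1) (V 4) / d, tripleDet (V 0) (V 3) (V 4) / d,
        tripleDet (V 0) (V 4) (V 5) / d],
      ![tripleDet (V 0) (V 1) (V 2) / d, tripleDet (V 0) (V 2) (V 3) / d,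
        tripleDet (V 0) (V 2) (V 5) / d]] with hx
  have hV : V = hexagonOf (V 0) (V 2) (V 4) x := by
    have hc : ∀ y, y = (tripleDet y (V 2) (V 4) / d) • V 0 + (tripleDet (V 0) y (V 4) / d) • V 2 +
        (tripleDet (V 0) (V 2) y / d) • V 4 := fun y => by
      have := congrArg (fun z => d⁻¹ • z) (tripleDet_cramer (V 0) (V 2) (V 4) y)
      simpa only [← hd_def, smul_add, smul_smul, inv_mul_cancel₀ hd.ne', one_smul,
        inv_mul_eq_div] using this
    funext i
    fin_cases i
    · rfl
    · refine (hc (V 1)).trans ?_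
      rw [tripleDet_swap_right (V 0) (V 1) (V 2)]
      simp [hexagonOf, hx, neg_div, sub_eq_add_neg]
    · rfl
    · refine (hc (V 3)).trans ?_
      rw [tripleDet_swap_left (V 2) (V 3) (V 4)]
      simp [hexagonOf, hx, neg_div, sub_eq_add_neg]
    · rfl
    · refine (hc (V 5)).trans ?_
      rw [← tripleDet_rotate (V 5), tripleDet_swap_right (V 0) (V 4) (V 5)]
      simp [hexagonOf, hx, neg_div, sub_eq_add_neg]
  have hedge : ∀ i k : Fin 6, k ≠ i → k ≠ i + 1 → 0 < edgeMinor x i k := by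
    intro i k hk hk'
    have h := hpos i k hk hk'
    rw [hV, tripleDet_hexagonOf_edge] at h
    exact pos_of_mul_pos_left h hd.le
  refine ⟨V 0, V 2, V 4, x, hd, ⟨?_, ?_, ?_, ?_, ?_, ?_⟩, hV⟩
  · intro i j
    fin_cases i <;> fin_cases j <;>
      exact div_pos (hpos.tripleDet_pos (by decide) (by decide)) hd
  · exact sub_pos.1 (hedge 0 5 (by decide) (by decide))
  · exact sub_pos.1 (hedge 1 3 (by decide) (by decide))
  · exact sub_pos.1 (hedge 3 5 (by decide) (by decide))
  · rw [hV, diagBracket_hexagonOf] at hD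
    exact sub_pos.1 (pos_of_mul_pos_left hD (pow_pos hd 2).le)
  · rw [hV, conicBracket_hexagonOf] at hQ
    exact sub_pos.1 (pos_of_mul_pos_left hQ (pow_pos hd 4).le)

/-- The part of `coordCell` cut out by inequalities that are linear in the logarithms of the
coordinates. -/
def logConvexCell : Set (Fin 3 → Fin 3 → ℝ) :=
  {x | (∀ i j, 0 < x i j) ∧ x 2 0 * x 1 2 < x 1 0 * x 2 2 ∧ x 0 1 * x 2 0 < x 0 0 * x 2 1 ∧
    x 0 1 * x 1 2 < x 0 2 * x 1 1 ∧ x 0 2 * x 1 0 * x 2 1 < x 0 0 * x 1 1 * x 2 2 ∧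
    x 0 2 * x 1 0 * x 2 1 < x 0 1 * x 1 2 * x 2 0}

theorem logConvexCell_subset_coordCell : logConvexCell ⊆ coordCell := by
  rintro x ⟨hpos, h1, h2, h3, h4, h5⟩
  refine ⟨hpos, h1, h2, h3, h4, ?_⟩
  have hx00 := hpos 0 0
  have hx01 := hpos 0 1
  have hx02 := hpos 0 2
  have hx10 := hpos 1 0
  have hx11 := hpos 1 1
  have hx12 := hpos 1 2
  have hx20 := hpos 2 0
  have hx21 := hpos 2 1
  have hx22 := hpos 2 2
  refine (mul_lt_mul_of_pos_left h5 (by positivity)).trans_le ?_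
  simp only [add_assoc]
  exact le_add_of_nonneg_right (by positivity)

theorem convex_log_logConvexCell :
    Convex ℝ {m : Fin 3 → Fin 3 → ℝ | (fun i j => Real.exp (m i j)) ∈ logConvexCell} := by
  have aux : ∀ {a b p q p' q' : ℝ}, 0 ≤ a → 0 ≤ b → a + b = 1 → p < q → p' < q' →
      a * p + b * p' < a * q + b * q' := by
    intro a b p q p' q' ha hb hab h h'
    rcases ha.eq_or_lt with rfl | ha
    · rw [zero_add] at hab
      simpa [hab] using h'
    · exact add_lt_add_of_lt_of_le (mul_lt_mul_of_pos_left h ha)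
        (mul_le_mul_of_nonneg_left h'.le hb)
  intro m hm m' hm' a b ha hb hab
  simp only [logConvexCell, Set.mem_ofPred_eq, ← Real.exp_add, Real.exp_lt_exp, Pi.add_apply,
    Pi.smul_apply, smul_eq_mul] at hm hm' ⊢
  obtain ⟨-, h1, h2, h3, h4, h5⟩ := hm
  obtain ⟨-, h1', h2', h3', h4', h5'⟩ := hm'
  refine ⟨fun _ _ => Real.exp_pos _, ?_, ?_, ?_, ?_, ?_⟩
  · linarith [aux ha hb hab h1 h1']
  · linarith [aux ha hb hab h2 h2']
  · linarith [aux ha hb hab h3 h3']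
  · linarith [aux ha hb hab h4 h4']
  · linarith [aux ha hb hab h5 h5']

theorem joinedIn_coordCell_of_mem_logConvexCell {x y : Fin 3 → Fin 3 → ℝ}
    (hx : x ∈ logConvexCell) (hy : y ∈ logConvexCell) : JoinedIn coordCell x y := by
  have hexp : ∀ z ∈ logConvexCell, (fun i j => Real.exp (Real.log (z i j))) = z := fun z hz => by
    funext i j
    exact Real.exp_log (hz.1 i j)
  have j := (JoinedIn.of_segment_subset (convex_log_logConvexCell.segment_subset
    (x := fun i j => Real.log (x i j)) (y := fun i j => Real.log (y i j))
    (by rw [Set.mem_ofPred_eq, hexp x hx]; exact hx)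
    (by rw [Set.mem_ofPred_eq, hexp y hy]; exact hy))).map
    (f := fun m i j => Real.exp (m i j)) (by fun_prop)
  rw [hexp x hx, hexp y hy] at j
  refine j.mono ?_
  rintro _ ⟨m, hm, rfl⟩
  exact logConvexCell_subset_coordCell hm

/-- A flow preserving `coordCell` and eventually entering `logConvexCell`. -/
def coordFlow (x : Fin 3 → Fin 3 → ℝ) (s : ℝ) : Fin 3 → Fin 3 → ℝ :=
  ![![Real.exp s * x 0 0, x 0 1, Real.exp (-s) * x 0 2],
    ![Real.exp (-s) * x 1 0, Real.exp s * x 1 1, x 1 2],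
    ![x 2 0, Real.exp (-s) * x 2 1, Real.exp s * x 2 2]]

theorem continuous_coordFlow (x : Fin 3 → Fin 3 → ℝ) : Continuous (coordFlow x) := by
  refine continuous_pi fun i => continuous_pi fun j => ?_
  fin_cases i <;> fin_cases j <;> simp [coordFlow] <;> fun_prop

theorem coordFlow_zero (x : Fin 3 → Fin 3 → ℝ) : coordFlow x 0 = x := by
  funext i j
  fin_cases i <;> fin_cases j <;> simp [coordFlow]

theorem coordFlow_mem_coordCell {x : Fin 3 → Fin 3 → ℝ} (hx : x ∈ coordCell) {s : ℝ}
    (hs : 0 ≤ s) : coordFlow x s ∈ coordCell := by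
  obtain ⟨hpos, h1, h2, h3, h4, h5⟩ := hx
  have hp := Real.exp_pos s
  have hq := Real.exp_pos (-s)
  have hpq : Real.exp s * Real.exp (-s) = 1 := by rw [← Real.exp_add, add_neg_cancel, Real.exp_zero]
  have hp1 : 1 ≤ Real.exp s := Real.one_le_exp hs
  have hq1 : Real.exp (-s) ≤ 1 := Real.exp_le_one_iff.2 (neg_nonpos.2 hs)
  simp only [coordCell, coordFlow, Set.mem_ofPred_eq]
  generalize Real.exp s = p at *
  generalize Real.exp (-s) = q at *
  have hx00 := hpos 0 0
  have hx01 := hpos 0 1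
  have hx02 := hpos 0 2
  have hx10 := hpos 1 0
  have hx11 := hpos 1 1
  have hx12 := hpos 1 2
  have hx20 := hpos 2 0
  have hx21 := hpos 2 1
  have hx22 := hpos 2 2
  have hC : 0 < x 0 1 * x 1 2 * x 2 0 := by positivity
  have hA : 0 < x 0 0 * x 1 1 * x 2 2 := by positivity
  have hD : 0 < x 0 2 * x 1 0 * x 2 1 := by positivity
  have hp3 : 1 ≤ p ^ 3 := one_le_pow₀ hp1
  have hq3 : q ^ 3 ≤ 1 := pow_le_one₀ hq.le hq1
  have hpq3 : p ^ 3 * q ^ 3 = 1 := by rw [← mul_pow, hpq, one_pow]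
  refine ⟨fun i j => ?_, ?_, ?_, ?_, ?_, ?_⟩
  · fin_cases i <;> fin_cases j <;> simp <;> positivity
  · simp
    linear_combination h1 - x 1 0 * x 2 2 * hpq
  · simp
    linear_combination h2 - x 0 0 * x 2 1 * hpq
  · simp
    linear_combination h3 - x 0 2 * x 1 1 * hpq
  · simp
    linear_combination h4 + mul_le_mul_of_nonneg_left hq3 hD.le +
      mul_le_mul_of_nonneg_left hp3 hA.le
  · have hdiff : q ^ 3 * (x 0 2 * x 1 0 * x 2 1) ≤ x 0 0 * x 1 1 * x 2 2 :=
      (mul_le_of_le_one_left hD.le hq3).trans h4.le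
    have key := mul_nonneg hC.le (mul_nonneg (sub_nonneg.2 hp3) (sub_nonneg.2 hdiff))
    simp
    linear_combination h5 + key + (x 0 0 * x 1 1 * x 2 2 * (x 0 2 * x 1 0 * x 2 1) -
        x 0 1 * x 1 2 * x 2 0 * (x 0 2 * x 1 0 * x 2 1)) * hpq3 -
      (x 0 1 * x 1 0 * x 2 2 * (x 0 2 * x 1 1 * x 2 0) +
        x 0 2 * x 1 1 * x 2 0 * (x 0 0 * x 1 2 * x 2 1) +
        x 0 1 * x 1 0 * x 2 2 * (x 0 0 * x 1 2 * x 2 1)) * (p * q + 1) * hpq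

theorem joinedIn_coordCell {x y : Fin 3 → Fin 3 → ℝ} (hx : x ∈ coordCell) (hy : y ∈ coordCell) :
    JoinedIn coordCell x y := by
  have main : ∀ x ∈ coordCell, ∃ y ∈ logConvexCell, JoinedIn coordCell x y := by
    intro x hx
    have hD : 0 < x 0 2 * x 1 0 * x 2 1 := mul_pos (mul_pos (hx.1 _ _) (hx.1 _ _)) (hx.1 _ _)
    have hC : 0 < x 0 1 * x 1 2 * x 2 0 := mul_pos (mul_pos (hx.1 _ _) (hx.1 _ _)) (hx.1 _ _)
    set s := x 0 2 * x 1 0 * x 2 1 / (x 0 1 * x 1 2 * x 2 0) with hs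
    have hs0 : 0 < s := div_pos hD hC
    have j := (JoinedIn.of_segment_subset ((convex_Ici (0 : ℝ)).segment_subset
      Set.self_mem_Ici hs0.le)).map (f := coordFlow x) (continuous_coordFlow x)
    rw [coordFlow_zero] at j
    refine ⟨coordFlow x s, ?_, j.mono ?_⟩
    · obtain ⟨hpos, h1, h2, h3, h4, -⟩ := coordFlow_mem_coordCell hx hs0.le
      refine ⟨hpos, h1, h2, h3, h4, ?_⟩
      have h : x 0 2 * x 1 0 * x 2 1 < Real.exp s * (x 0 1 * x 1 2 * x 2 0) := by
        rw [← div_lt_iff₀ hC]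
        exact (lt_add_one s).trans_le (Real.add_one_le_exp s)
      have hq1 : Real.exp (-s) ≤ 1 := Real.exp_le_one_iff.2 (neg_nonpos.2 hs0.le)
      have hq2 := mul_le_of_le_one_left (mul_nonneg (Real.exp_pos (-s)).le hD.le)
        (pow_le_one₀ (n := 2) (Real.exp_pos (-s)).le hq1)
      have hpq : Real.exp (-s) * Real.exp s = 1 := by
        rw [← Real.exp_add, neg_add_cancel, Real.exp_zero]
      have h' := mul_lt_mul_of_pos_left h (Real.exp_pos (-s))
      simp [coordFlow]
      linear_combination h' + hq2 + x 0 1 * x 1 2 * x 2 0 * hpq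
    · rintro _ ⟨t, ht, rfl⟩
      exact coordFlow_mem_coordCell hx ht
  obtain ⟨x', hx', jx⟩ := main x hx
  obtain ⟨y', hy', jy⟩ := main y hy
  exact (jx.trans (joinedIn_coordCell_of_mem_logConvexCell hx' hy')).trans jy.symm

theorem joinedIn_hexagonCell {V V' : Fin 6 → Fin 3 → ℝ} (hV : V ∈ hexagonCell)
    (hV' : V' ∈ hexagonCell) : JoinedIn hexagonCell V V' := by
  obtain ⟨u, v, w, x, hd, hx, rfl⟩ := exists_hexagonOf_of_mem_hexagonCell hV
  obtain ⟨u', v', w', x', hd', hx', rfl⟩ := exists_hexagonOf_of_mem_hexagonCell hV'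
  have j := ((joinedIn_tripleDet_pos hd hd').prod (joinedIn_coordCell hx hx')).map
    (f := fun p => hexagonOf p.1.1 p.1.2.1 p.1.2.2 p.2) (by
      refine continuous_pi fun i => ?_
      fin_cases i <;> simp [hexagonOf] <;> fun_prop)
  refine j.mono ?_
  rintro _ ⟨⟨⟨a, b, c⟩, y⟩, ⟨h, hy⟩, rfl⟩
  exact hexagonOf_mem_hexagonCell h hy

theorem PosEdges.ne_zero {V : Fin 6 → Fin 3 → ℝ} (h : PosEdges V) (i : Fin 6) : V i ≠ 0 := by
  intro h0
  have := h i (i + 1 + 1) (by clear * -; revert i; decide) (by clear * -; revert i; decide)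
  simp [tripleDet, h0] at this

theorem represents_mk {V : Fin 6 → Fin 3 → ℝ} (hV : ∀ i, V i ≠ 0) :
    Represents V fun i => Projectivization.mk ℝ (V i) (hV i) := fun i => by
  obtain ⟨c, hc⟩ := Projectivization.exists_smul_eq_mk_rep ℝ (V i) (hV i)
  exact ⟨c, c.ne_zero, hc.symm⟩

theorem Represents.mk_eq {V : Fin 6 → Fin 3 → ℝ} {f : Fin 6 → RP2} (h : Represents V f) {i : Fin 6}
    (hV : V i ≠ 0) : Projectivization.mk ℝ (V i) hV = f i := by
  obtain ⟨c, -, hc⟩ := h i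
  rw [← (f i).mk_rep, eq_comm, Projectivization.mk_eq_mk_iff']
  exact ⟨c, hc.symm⟩

/-- The space of hexagonal typical 6-configurations with non-concurrent principal diagonals
is path-connected: any two such configurations are joined by a Q-deformation all of whose
intermediate configurations are hexagonal typical with non-concurrent principal diagonals. -/
theorem nonconcurrent_hexagonal_connected
    (f g : Fin 6 → RP2) (hf : TypicalCfg f) (hg : TypicalCfg g)
    (hfc : ConsecConvexPos f) (hgc : ConsecConvexPos g)
    (hfd : ¬ DiagConcurrent f) (hgd : ¬ DiagConcurrent g) :
    ∃ γ : Fin 6 → unitInterval → RP2, (∀ i, Continuous (γ i)) ∧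
      (∀ i, γ i 0 = f i) ∧ (Set.range fun i => γ i 1) = Set.range g ∧
      ∀ t : unitInterval, TypicalCfg (fun i => γ i t) ∧
        ConsecConvexPos (fun i => γ i t) ∧ ¬ DiagConcurrent (fun i => γ i t) := by
  obtain ⟨σ, hσ, V, hV, hrep⟩ := NiceHexagon.exists_perm ⟨hf, hfc, hfd⟩
  obtain ⟨τ, -, V', hV', hrep'⟩ := NiceHexagon.exists_perm ⟨hg, hgc, hgd⟩
  let p := (joinedIn_hexagonCell hV hV').somePath
  have hp : ∀ t, p t ∈ hexagonCell := (joinedIn_hexagonCell hV hV').somePath_mem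
  have hne : ∀ t i, p t i ≠ 0 := fun t i => (hp t).1.ne_zero i
  have hcont : Continuous p := p.continuous
  refine ⟨fun i t => Projectivization.mk ℝ (p t (σ.symm i)) (hne t _), fun i => ?_, fun i => ?_,
    ?_, fun t => ?_⟩
  · exact continuous_quotient_mk'.comp
      (Continuous.subtype_mk ((continuous_apply (σ.symm i)).comp hcont) fun t => hne t _)
  · have h0 : p 0 = V := p.source
    simp only [h0]
    rw [hrep.mk_eq, Function.comp_apply, Equiv.apply_symm_apply]
  · have h1 : p 1 = V' := p.target
    simp only [h1, hrep'.mk_eq]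
    exact (σ.symm.trans τ).surjective.range_comp g
  · exact hσ (fun i => Projectivization.mk ℝ (p t i) (hne t i))
      ((represents_mk (hne t)).niceHexagon_of_mem_hexagonCell (hp t))

end
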